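/- Let p be a prime number, n ≥ 1, and B a commutative Noetherian ring such that p lies in every maximal ideal of B; let B̂ denote the p-adic completion of B. Then the natural map GL_n(B[1/p])/GL_n(B) → GL_n(B̂[1/p])/GL_n(B̂) induced by B → B̂ is a bijection. -/

import Mathlib

open Matrix

/-- The `p`-adic completion of `B`. -/
abbrev PadicCompletionRing (p : ℕ) (B : Type) [CommRing B] : Type :=
  AdicCompletion (Ideal.span {(p : B)}) B

/-- `B[1/p]`. -/
abbrev InvertP (p : ℕ) (B : Type) [CommRing B] : Type :=
  Localization.Away (p : B)

/-- `B̂[1/p]`. -/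
abbrev CompletionInvertP (p : ℕ) (B : Type) [CommRing B] : Type :=
  Localization.Away (algebraMap B (PadicCompletionRing p B) (p : B))

/-- The natural map `B[1/p] → B̂[1/p]`. -/
noncomputable abbrev invertPMap (p : ℕ) (B : Type) [CommRing B] :
    InvertP p B →+* CompletionInvertP p B :=
  Localization.awayMap (algebraMap B (PadicCompletionRing p B)) (p : B)

/-- The ring homomorphism `B → C` induces an isomorphism `B / π ^ N ≃ C / π ^ N` for every `N`. -/
structure InducesIsoModPow {B : Type*} (C : Type*) [CommRing B] [CommRing C] [Algebra B C]
    (π : B) : Prop where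
  exists_eq_add : ∀ (N : ℕ) (c : C), ∃ b y, c = algebraMap B C b + algebraMap B C π ^ N * y
  dvd_of_dvd : ∀ (N : ℕ) (b : B), algebraMap B C π ^ N ∣ algebraMap B C b → π ^ N ∣ b

/-- Perturbing a matrix by a multiple of `r` perturbs its determinant by a multiple of `r`. -/
lemma Matrix.exists_det_add_smul {R n : Type*} [CommRing R] [Fintype n] [DecidableEq n]
    (r : R) (A Y : Matrix n n R) : ∃ c, (A + r • Y).det = A.det + r * c := by
  have h : (A + r • Y).det - A.det ∈ Ideal.span {r} := by
    rw [← Ideal.Quotient.mk_eq_mk_iff_sub_mem, RingHom.map_det, RingHom.map_det]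
    congr 1
    ext i j
    simp
  obtain ⟨c, hc⟩ := Ideal.mem_span_singleton.mp h
  exact ⟨c, by rw [← hc]; ring⟩

lemma isUnit_one_add_mul_of_mem_jacobson {R : Type*} [CommRing R] {r : R}
    (hr : r ∈ Ideal.jacobson (⊥ : Ideal R)) (c : R) : IsUnit (1 + r * c) := by
  rw [add_comm]
  exact Ideal.mem_jacobson_bot.mp hr c

lemma Matrix.exists_pow_smul_eq_map {R S n : Type*} [Finite n] [CommRing R] [CommRing S]
    [Algebra R S] (r : R) [IsLocalization.Away r S] (A : Matrix n n S) :
    ∃ (k : ℕ) (M : Matrix n n R), algebraMap R S r ^ k • A = M.map (algebraMap R S) := by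
  obtain ⟨⟨_, k, rfl⟩, hk⟩ := IsLocalization.exist_integer_multiples_of_finite
    (Submonoid.powers r) fun ij : n × n ↦ A ij.1 ij.2
  choose M hM using hk
  refine ⟨k, of fun i j ↦ M (i, j), ?_⟩
  ext i j
  simp [hM, Algebra.smul_def]

namespace InducesIsoModPow

variable {B C BL CL n : Type*} [CommRing B] [CommRing C] [Algebra B C] {π : B}

lemma exists_matrix_eq_add (H : InducesIsoModPow C π) (N : ℕ) (A : Matrix n n C) :
    ∃ (M : Matrix n n B) (Y : Matrix n n C),
      A = M.map (algebraMap B C) + algebraMap B C π ^ N • Y := by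
  choose b y h using H.exists_eq_add N
  exact ⟨A.map b, A.map y, by ext i j; simpa using h (A i j)⟩

/-- If `b * c ≡ π ^ m` modulo `π ^ (m + 1)` for some `c : C`, then `b` divides `π ^ m`. -/
lemma dvd_pow (H : InducesIsoModPow C π) (hB : π ∈ Ideal.jacobson (⊥ : Ideal B)) (m : ℕ) {b : B}
    {c y : C} (h : algebraMap B C b * c = algebraMap B C π ^ m + algebraMap B C π ^ (m + 1) * y) :
    b ∣ π ^ m := by
  obtain ⟨b', y', rfl⟩ := H.exists_eq_add (m + 1) c
  obtain ⟨z, hz⟩ := H.dvd_of_dvd (m + 1) (b * b' - π ^ m)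
    ⟨y - algebraMap B C b * y', by simp only [map_sub, map_mul, map_pow]; linear_combination h⟩
  obtain ⟨u, hu⟩ := isUnit_one_add_mul_of_mem_jacobson hB z
  refine ⟨b' * ↑u⁻¹, ?_⟩
  have hu' : (1 + π * z) * ↑u⁻¹ = 1 := by rw [← hu]; exact u.mul_inv
  linear_combination (-(↑u⁻¹ : B)) * hz - π ^ m * hu'

variable [CommRing BL] [CommRing CL] [Algebra B BL] [Algebra C CL] [IsLocalization.Away π BL]
  [IsLocalization.Away (algebraMap B C π) CL] {f : BL →+* CL}

/-- An element of `B[1/π]` whose image in `C[1/π]` lies in the image of `π ^ N * C` lies in the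
image of `π ^ N * B`. -/
lemma exists_eq_algebraMap_pow_mul (H : InducesIsoModPow C π)
    (hf : ∀ b, f (algebraMap B BL b) = algebraMap C CL (algebraMap B C b)) (N : ℕ) {x : BL} {c : C}
    (h : f x = algebraMap C CL (algebraMap B C π ^ N * c)) :
    ∃ b, x = algebraMap B BL (π ^ N * b) := by
  obtain ⟨k, b₀, hb₀⟩ := IsLocalization.Away.surj π x
  have h₁ : algebraMap C CL (algebraMap B C b₀) =
      algebraMap C CL (algebraMap B C π ^ (k + N) * c) := by
    rw [← hf, ← hb₀]
    simp only [map_mul, map_pow, h, hf]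
    ring
  obtain ⟨m, hm⟩ := IsLocalization.Away.exists_of_eq (algebraMap B C π) h₁
  obtain ⟨b, hb⟩ := H.dvd_of_dvd (m + (k + N)) (π ^ m * b₀)
    ⟨c, by rw [map_mul, map_pow, hm]; ring⟩
  refine ⟨b, ?_⟩
  have hu : IsUnit (algebraMap B BL π ^ (m + k)) :=
    (IsLocalization.Away.algebraMap_isUnit π).pow _
  refine hu.mul_left_cancel ?_
  have hb' := congrArg (algebraMap B BL) hb
  simp only [map_mul, map_pow] at hb' ⊢
  linear_combination hb' + algebraMap B BL π ^ m * hb₀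

variable [Fintype n] [DecidableEq n]

theorem mem_range_of_map_mem_range (H : InducesIsoModPow C π)
    (hB : π ∈ Ideal.jacobson (⊥ : Ideal B))
    (hf : ∀ b, f (algebraMap B BL b) = algebraMap C CL (algebraMap B C b)) {g : GL n BL}
    (hg : GeneralLinearGroup.map f g ∈ (GeneralLinearGroup.map (n := n) (algebraMap C CL)).range) :
    g ∈ (GeneralLinearGroup.map (n := n) (algebraMap B BL)).range := by
  obtain ⟨h, hh⟩ := hg
  obtain ⟨M, Y, hMY⟩ := H.exists_matrix_eq_add 1 (h : Matrix n n C)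
  have hz (i j) : ∃ z, g i j - algebraMap B BL (M i j) = algebraMap B BL (π ^ 1 * z) := by
    refine H.exists_eq_algebraMap_pow_mul (CL := CL) hf 1 (c := Y i j) ?_
    have h₁ : algebraMap C CL (h i j) = f (g i j) := congrArg (fun a : GL n CL ↦ a i j) hh
    have h₂ := congrFun₂ hMY i j
    simp only [Matrix.add_apply, map_apply, Matrix.smul_apply, smul_eq_mul] at h₂
    rw [map_sub, ← h₁, hf, h₂, map_add, add_sub_cancel_left]
  choose Z hZ using hz
  have hM : (M + π • of Z).map (algebraMap B C) =
      (h : Matrix n n C) + algebraMap B C π • ((of Z).map (algebraMap B C) - Y) := by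
    rw [hMY, pow_one]
    ext i j
    simp only [map_apply, Matrix.add_apply, Matrix.sub_apply, Matrix.smul_apply, of_apply,
      smul_eq_mul, map_add, map_mul]
    ring
  have hdet : IsUnit (M + π • of Z).det := by
    obtain ⟨c, hc⟩ := exists_det_add_smul (algebraMap B C π) (h : Matrix n n C)
      ((of Z).map (algebraMap B C) - Y)
    rw [← hM, ← RingHom.mapMatrix_apply, ← RingHom.map_det] at hc
    obtain ⟨u, hu⟩ := (isUnits_det_units h)
    rw [← hu] at hc
    refine isUnit_of_dvd_one ?_
    rw [← pow_zero π]
    refine H.dvd_pow hB 0 (c := ↑u⁻¹) (y := c * ↑u⁻¹) ?_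
    rw [hc, add_mul, u.mul_inv]
    ring
  refine ⟨GeneralLinearGroup.mk'' _ hdet, ?_⟩
  ext i j
  change algebraMap B BL ((M + π • of Z) i j) = g i j
  have := hZ i j
  simp only [pow_one] at this
  simp only [Matrix.add_apply, Matrix.smul_apply, of_apply, smul_eq_mul, map_add, ← this]
  ring

theorem exists_inv_map_mul_mem_range (H : InducesIsoModPow C π)
    (hB : π ∈ Ideal.jacobson (⊥ : Ideal B))
    (hC : algebraMap B C π ∈ Ideal.jacobson (⊥ : Ideal C))
    (hf : ∀ b, f (algebraMap B BL b) = algebraMap C CL (algebraMap B C b)) (g' : GL n CL) :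
    ∃ g : GL n BL, (GeneralLinearGroup.map f g)⁻¹ * g' ∈
      (GeneralLinearGroup.map (n := n) (algebraMap C CL)).range := by
  obtain ⟨k, A, hA⟩ := exists_pow_smul_eq_map (algebraMap B C π) (g' : Matrix n n CL)
  obtain ⟨l, D, hD⟩ := exists_pow_smul_eq_map (algebraMap B C π) ((g'⁻¹ : GL n CL) : Matrix n n CL)
  obtain ⟨M, Y, hMY⟩ := H.exists_matrix_eq_add (k + l + 1) A
  have hU : IsUnit (1 + algebraMap B C π • -(D * Y)).det := by
    obtain ⟨c, hc⟩ := exists_det_add_smul (algebraMap B C π) 1 (-(D * Y))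
    rw [hc, det_one]
    exact isUnit_one_add_mul_of_mem_jacobson hC c
  let U : GL n C := GeneralLinearGroup.mk'' _ hU
  let F := (algebraMap C CL).mapMatrix (m := n)
  set P := algebraMap C CL (algebraMap B C π)
  have hP : IsUnit P := IsLocalization.Away.algebraMap_isUnit _
  have hFsmul (c : C) (X : Matrix n n C) : F (c • X) = algebraMap C CL c • F X := by
    ext i j
    simp [F]
  have key : f.mapMatrix ((algebraMap B BL).mapMatrix M) = P ^ k • (g'.val * F U) := by
    have h₁ : f.mapMatrix ((algebraMap B BL).mapMatrix M) = F (M.map (algebraMap B C)) := by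
      ext i j
      simp [F, hf]
    have h₂ : F A = P ^ k • g'.val := hA.symm
    have h₃ : F D = P ^ l • (g'⁻¹).val := hD.symm
    have h₄ : U.val = 1 + algebraMap B C π • -(D * Y) := rfl
    have h₅ : F A = F (M.map (algebraMap B C)) + P ^ (k + l + 1) • F Y := by
      rw [hMY, map_add, hFsmul, map_pow]
    have h₆ : g'.val * (g'⁻¹).val = 1 := g'.mul_inv
    rw [h₁, eq_sub_of_add_eq h₅.symm, h₂, h₄, map_add, map_one, hFsmul, map_neg, map_mul, h₃,
      mul_add, mul_one, Matrix.mul_smul, mul_neg, Matrix.smul_mul, Matrix.mul_smul,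
      ← Matrix.mul_assoc, h₆, Matrix.one_mul, smul_add, smul_neg, smul_neg, smul_smul, smul_smul,
      ← sub_eq_add_neg, add_assoc, pow_add, pow_succ', mul_assoc]
  have hFU : IsUnit (F U) := U.isUnit.map F
  have hdet : IsUnit (algebraMap B BL M.det) := by
    have h₁ : IsUnit (algebraMap C CL (algebraMap B C M.det)) := by
      rw [← hf, RingHom.map_det, RingHom.map_det, key, det_smul]
      exact ((hP.pow k).pow _).mul ((isUnit_iff_isUnit_det _).mp (g'.isUnit.mul hFU))
    obtain ⟨w, hw⟩ := h₁.exists_right_inv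
    obtain ⟨m, c, hc⟩ := IsLocalization.Away.surj (algebraMap B C π) w
    have h₂ : algebraMap C CL (algebraMap B C M.det * c) =
        algebraMap C CL (algebraMap B C π ^ m) := by
      rw [map_mul, ← hc, ← mul_assoc, hw, one_mul, map_pow]
    obtain ⟨q, hq⟩ := IsLocalization.Away.exists_of_eq (algebraMap B C π) h₂
    have h₃ : M.det ∣ π ^ (q + m) :=
      H.dvd_pow hB (q + m) (c := algebraMap B C π ^ q * c) (y := 0)
        (by linear_combination hq)
    refine isUnit_of_dvd_unit (map_dvd (algebraMap B BL) h₃) ?_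
    rw [map_pow]
    exact (IsLocalization.Away.algebraMap_isUnit π).pow _
  obtain ⟨u, hu⟩ := (IsLocalization.Away.algebraMap_isUnit (S := BL) π).pow k
  have hg : IsUnit ((↑u⁻¹ : BL) • (algebraMap B BL).mapMatrix M).det := by
    rw [det_smul, ← RingHom.map_det]
    exact (u⁻¹.isUnit.pow _).mul hdet
  refine ⟨GeneralLinearGroup.mk'' _ hg, U⁻¹, ?_⟩
  rw [map_inv, eq_inv_mul_iff_mul_eq, mul_inv_eq_iff_eq_mul]
  ext i j
  change f ((↑u⁻¹ : BL) * algebraMap B BL (M i j)) = (g'.val * F U) i j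
  refine (hP.pow k).mul_left_cancel ?_
  have h₁ : f (algebraMap B BL (M i j)) = P ^ k * (g'.val * F U) i j := congrFun₂ key i j
  have h₂ : P ^ k = f u := by rw [hu, map_pow, hf]
  rw [← h₁, h₂, ← map_mul, u.mul_inv_cancel_left]

end InducesIsoModPow

lemma inducesIsoModPow_adicCompletion {B : Type*} [CommRing B] (π : B) :
    InducesIsoModPow (AdicCompletion (Ideal.span {π}) B) π where
  exists_eq_add N c := by
    obtain ⟨b, hb⟩ := Submodule.Quotient.mk_surjective _ (c.val N)
    have h : c - algebraMap B _ b ∈ (AdicCompletion.eval (Ideal.span {π}) B N).ker := by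
      rw [LinearMap.mem_ker, map_sub, sub_eq_zero]
      exact hb.symm
    rw [← AdicCompletion.pow_smul_top_eq_ker_eval (Submodule.fg_span_singleton π),
      Ideal.span_singleton_pow, Submodule.ideal_span_singleton_smul] at h
    obtain ⟨y, -, hy⟩ := (Submodule.mem_smul_pointwise_iff_exists _ _ _).mp h
    refine ⟨b, y, ?_⟩
    rw [← map_pow, ← Algebra.smul_def, hy, add_sub_cancel]
  dvd_of_dvd N b h := by
    have h₁ := map_dvd (AdicCompletion.evalₐ (Ideal.span {π}) N) h
    rw [map_pow, AlgHom.commutes, AlgHom.commutes, ← map_pow] at h₁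
    obtain ⟨y, hy⟩ := h₁
    have h₂ : π ^ N ∈ Ideal.span {π} ^ N :=
      Ideal.pow_mem_pow (Ideal.mem_span_singleton_self π) N
    rw [Ideal.Quotient.algebraMap_eq, Ideal.Quotient.eq_zero_iff_mem.mpr h₂, zero_mul,
      Ideal.Quotient.eq_zero_iff_mem, Ideal.span_singleton_pow] at hy
    exact Ideal.mem_span_singleton.mp hy

lemma algebraMap_mem_jacobson_adicCompletion {B : Type*} [CommRing B] (π : B) :
    algebraMap B (AdicCompletion (Ideal.span {π}) B) π ∈ Ideal.jacobson ⊥ := by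
  have := AdicCompletion.isAdicComplete_self (Ideal.span {π}) (Submodule.fg_span_singleton π)
  exact IsAdicComplete.le_jacobson_bot _
    (Ideal.mem_map_of_mem _ (Ideal.mem_span_singleton_self π))

/-- The natural map `GL_n(B[1/p])/GL_n(B) → GL_n(B̂[1/p])/GL_n(B̂)` is a bijection;
formulated as injectivity and surjectivity on cosets of the images of `GL_n(B)`
resp. `GL_n(B̂)`. -/
theorem statement18 (p : ℕ) (hp : p.Prime) (n : ℕ) (hn : 1 ≤ n)
    (B : Type) [CommRing B] [IsNoetherianRing B]
    (hmax : ∀ m : Ideal B, m.IsMaximal → (p : B) ∈ m) :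
    (∀ g₁ g₂ : GL (Fin n) (InvertP p B),
      (Matrix.GeneralLinearGroup.map (invertPMap p B) g₁)⁻¹ *
          Matrix.GeneralLinearGroup.map (invertPMap p B) g₂ ∈
        (Matrix.GeneralLinearGroup.map (n := Fin n)
          (algebraMap (PadicCompletionRing p B) (CompletionInvertP p B))).range →
      g₁⁻¹ * g₂ ∈
        (Matrix.GeneralLinearGroup.map (n := Fin n) (algebraMap B (InvertP p B))).range) ∧
    ∀ g' : GL (Fin n) (CompletionInvertP p B), ∃ g : GL (Fin n) (InvertP p B),
      (Matrix.GeneralLinearGroup.map (invertPMap p B) g)⁻¹ * g' ∈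
        (Matrix.GeneralLinearGroup.map (n := Fin n)
          (algebraMap (PadicCompletionRing p B) (CompletionInvertP p B))).range := by
  have H := inducesIsoModPow_adicCompletion (p : B)
  have hB : (p : B) ∈ Ideal.jacobson ⊥ := Ideal.mem_sInf.mpr fun {m} hm ↦ hmax m hm.2
  have hf (b : B) : invertPMap p B (algebraMap B (InvertP p B) b) =
      algebraMap (PadicCompletionRing p B) (CompletionInvertP p B)
        (algebraMap B (PadicCompletionRing p B) b) := IsLocalization.map_eq _ b
  refine ⟨fun g₁ g₂ h ↦ H.mem_range_of_map_mem_range hB hf ?_,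
    H.exists_inv_map_mul_mem_range hB (algebraMap_mem_jacobson_adicCompletion _) hf⟩
  rwa [map_mul, map_inv]
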